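/- arXiv:2003.06028 — 2 statements merged into one kernel-verified Lean document; each statement's English description precedes it below -/
import Mathlib

section
/- Let N ≥ 1, let x_1, …, x_N ∈ ℝ^n be equally-weighted samples with sample mean x̄ and sample covariance Σ^{xx} = (1/N) Σ_i (x_i − x̄)(x_i − x̄)^T, and let the constraint function be affine, g(x) = G x + c with G ∈ ℝ^{s×n}, c ∈ ℝ^s. Assume the constraint sample covariance Σ^{dd} = G Σ^{xx} G^T is invertible, and set K := Σ^{xd} (Σ^{dd})^{-1} = Σ^{xx} G^T (G Σ^{xx} G^T)^{-1} and d̂ := (1/N) Σ_i g(x_i). Then the projected samples x_i^p := x_i − K (g(x_i) − d̂) satisfy the constraint exactly at the ensemble level: g(x_i^p) = d̂ for every i = 1, …, N. -/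
open Finset Matrix

/-- **Exactness of the projection step for affine constraints.**
For equally-weighted samples `x i ∈ ℝ^n` with sample mean `x̄` and sample
covariance `Σˣˣ`, and an affine constraint `g x = G x + c`, assume the
constraint sample covariance `Σᵈᵈ = G Σˣˣ Gᵀ` is invertible and set
`K = Σˣᵈ (Σᵈᵈ)⁻¹ = Σˣˣ Gᵀ (G Σˣˣ Gᵀ)⁻¹`. Then the projected samples
`xᵖ i = x i − K (g (x i) − d̂)` satisfy `g (xᵖ i) = d̂` for every `i`. -/
theorem affine_projection_satisfies_constraint (N n s : ℕ) (hN : 1 ≤ N)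
    (x : Fin N → (Fin n → ℝ))
    (xbar : Fin n → ℝ) (hxbar : xbar = (1 / (N : ℝ)) • ∑ i, x i)
    (Sxx : Matrix (Fin n) (Fin n) ℝ)
    (hSxx : Sxx = (1 / (N : ℝ)) • ∑ i, vecMulVec (x i - xbar) (x i - xbar))
    (G : Matrix (Fin s) (Fin n) ℝ) (c : Fin s → ℝ)
    (g : (Fin n → ℝ) → (Fin s → ℝ)) (hg : ∀ v, g v = G.mulVec v + c)
    (dhat : Fin s → ℝ) (hdhat : dhat = (1 / (N : ℝ)) • ∑ i, g (x i))
    (Sdd : Matrix (Fin s) (Fin s) ℝ)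
    (hSdd : Sdd = (1 / (N : ℝ)) • ∑ i, vecMulVec (g (x i) - dhat) (g (x i) - dhat))
    (hSdd_eq : Sdd = G * Sxx * Gᵀ)
    (hSdd_inv : IsUnit Sdd)
    (Sxd : Matrix (Fin n) (Fin s) ℝ)
    (hSxd : Sxd = (1 / (N : ℝ)) • ∑ i, vecMulVec (x i - xbar) (g (x i) - dhat))
    (K : Matrix (Fin n) (Fin s) ℝ) (hK : K = Sxd * Sdd⁻¹)
    (hK' : K = Sxx * Gᵀ * (G * Sxx * Gᵀ)⁻¹)
    (xp : Fin N → (Fin n → ℝ))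
    (hxp : ∀ i, xp i = x i - K.mulVec (g (x i) - dhat)) :
    ∀ i, g (xp i) = dhat := by
  have hGK : G * K = 1 := by
    rw [hK', ← Matrix.mul_assoc, ← Matrix.mul_assoc, ← hSdd_eq]
    exact Matrix.mul_nonsing_inv _ ((Matrix.isUnit_iff_isUnit_det _).1 hSdd_inv)
  intro i
  calc g (xp i) = g (x i) - (G * K) *ᵥ (g (x i) - dhat) := by
        rw [hg (xp i), hxp i, Matrix.mulVec_sub, Matrix.mulVec_mulVec, sub_add_eq_add_sub, ← hg]
    _ = dhat := by rw [hGK, Matrix.one_mulVec, sub_sub_cancel]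
end

section
/- Let L > 0 and g ∈ ℝ, and let x, y : ℝ → ℝ be twice differentiable functions satisfying the pendulum kinematics ẍ(t) = (1/L²)(−g·x(t)·y(t) − x(t)(ẋ(t)² + ẏ(t)²)) and ÿ(t) = (1/L²)(g·x(t)² − y(t)(ẋ(t)² + ẏ(t)²)) for all t ≥ 0, with ẋ and ẏ continuous. If the initial conditions satisfy x(0)² + y(0)² = L² and x(0)ẋ(0) + y(0)ẏ(0) = 0, then x(t)² + y(t)² = L² for all t ≥ 0; that is, the length constraint is an invariant of the pendulum dynamics. -/
/-- Uniqueness of the zero solution of the linear system `u' = 2 v`, `v' = -c(t) u`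
on `[0, ∞)` with continuous coefficient `c`. -/
theorem eq_zero_of_linear_system {u v c : ℝ → ℝ} (hc : Continuous c)
    (hu : ∀ t ≥ (0 : ℝ), HasDerivAt u (2 * v t) t)
    (hv : ∀ t ≥ (0 : ℝ), HasDerivAt v (-c t * u t) t)
    (hu0 : u 0 = 0) (hv0 : v 0 = 0) : ∀ t ≥ (0 : ℝ), u t = 0 := by
  intro T hT
  obtain ⟨K, hK⟩ := isCompact_Icc.exists_bound_of_continuousOn
    (s := Set.Icc (0 : ℝ) T) hc.continuousOn
  have hderiv : ∀ t ∈ Set.Icc (0 : ℝ) T,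
      HasDerivAt (fun s => (u s, v s)) (2 * v t, -c t * u t) t :=
    fun t ht => (hu t ht.1).prodMk (hv t ht.1)
  have hzero := eq_zero_of_abs_deriv_le_mul_abs_self_of_eq_zero_right
    (f := fun s => (u s, v s)) (f' := fun s => (2 * v s, -c s * u s)) (K := max 2 K)
    (fun t ht => (hderiv t ht).continuousAt.continuousWithinAt)
    (fun t ht => (hderiv t (Set.Ico_subset_Icc_self ht)).hasDerivWithinAt)
    (by simp [hu0, hv0])
    (by
      intro t ht
      have hct := hK t (Set.Ico_subset_Icc_self ht)
      refine norm_prod_le_iff.2 ⟨?_, ?_⟩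
      · rw [norm_mul, Real.norm_two]
        exact mul_le_mul (le_max_left _ _) (norm_snd_le (u t, v t)) (norm_nonneg _)
          (by positivity)
      · rw [norm_mul, norm_neg]
        exact mul_le_mul (hct.trans (le_max_right _ _)) (norm_fst_le (u t, v t))
          (norm_nonneg _) (by positivity))
    T ⟨hT, le_rfl⟩
  exact congrArg Prod.fst hzero

/-- **The length constraint is an invariant of the Cartesian pendulum dynamics.**
If `x, y : ℝ → ℝ` are twice differentiable with continuous first derivatives
and satisfy the pendulum kinematics
`ẍ = (1/L²)(−g x y − x(ẋ² + ẏ²))` and `ÿ = (1/L²)(g x² − y(ẋ² + ẏ²))` for all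
`t ≥ 0`, and the initial conditions satisfy `x(0)² + y(0)² = L²` and
`x(0)ẋ(0) + y(0)ẏ(0) = 0`, then `x(t)² + y(t)² = L²` for all `t ≥ 0`. -/
theorem pendulum_length_invariant (L g : ℝ) (hL : 0 < L) (x y : ℝ → ℝ)
    (hx : ∀ t, DifferentiableAt ℝ x t)
    (hx' : ∀ t, DifferentiableAt ℝ (deriv x) t)
    (hy : ∀ t, DifferentiableAt ℝ y t)
    (hy' : ∀ t, DifferentiableAt ℝ (deriv y) t)
    (hxc : Continuous (deriv x)) (hyc : Continuous (deriv y))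
    (hddx : ∀ t ≥ (0 : ℝ), deriv (deriv x) t =
      (1 / L ^ 2) * (-g * x t * y t - x t * ((deriv x t) ^ 2 + (deriv y t) ^ 2)))
    (hddy : ∀ t ≥ (0 : ℝ), deriv (deriv y) t =
      (1 / L ^ 2) * (g * (x t) ^ 2 - y t * ((deriv x t) ^ 2 + (deriv y t) ^ 2)))
    (hinit : (x 0) ^ 2 + (y 0) ^ 2 = L ^ 2)
    (hinit' : x 0 * deriv x 0 + y 0 * deriv y 0 = 0) :
    ∀ t ≥ (0 : ℝ), (x t) ^ 2 + (y t) ^ 2 = L ^ 2 := by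
  intro t ht
  have hL0 : L ≠ 0 := hL.ne'
  have hu : ∀ s ≥ (0 : ℝ), HasDerivAt (fun s => x s ^ 2 + y s ^ 2 - L ^ 2)
      (2 * (x s * deriv x s + y s * deriv y s)) s := by
    intro s _
    refine ((((hx s).hasDerivAt.pow 2).add ((hy s).hasDerivAt.pow 2)).sub_const
      (L ^ 2)).congr_deriv ?_
    push_cast
    ring
  have hv : ∀ s ≥ (0 : ℝ), HasDerivAt (fun s => x s * deriv x s + y s * deriv y s)
      (-(((deriv x s) ^ 2 + (deriv y s) ^ 2) / L ^ 2) * (x s ^ 2 + y s ^ 2 - L ^ 2)) s := by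
    intro s hs
    refine (((hx s).hasDerivAt.mul (hx' s).hasDerivAt).add
      ((hy s).hasDerivAt.mul (hy' s).hasDerivAt)).congr_deriv ?_
    rw [hddx s hs, hddy s hs]
    field_simp
    ring
  have hc : Continuous fun s => ((deriv x s) ^ 2 + (deriv y s) ^ 2) / L ^ 2 :=
    ((hxc.pow 2).add (hyc.pow 2)).div_const _
  exact sub_eq_zero.1
    (eq_zero_of_linear_system hc hu hv (sub_eq_zero.2 hinit) hinit' t ht)
end
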